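/- Let (Ω, 𝓕) be a measurable space whose σ-field 𝓕 is not reduced to {∅, Ω}, and let f ∈ 𝔽 be finite on (0, ∞), i.e. (0, ∞) ⊆ dom(f). Then the range of the f-divergence over all pairs of probability measures on (Ω, 𝓕) is exactly the interval [0, f(0) + f*(0)]: {D_f(P‖Q) : P, Q probability measures on (Ω, 𝓕)} = [0, f(0) + f*(0)]. -/

import Mathlib

open MeasureTheory ProbabilityTheory Filter Set Topology
open scoped ENNReal NNReal

noncomputable section

/-- Extended-real positive part, as a value in `ℝ≥0∞`. -/
def EReal.toENNReal' (x : EReal) : ℝ≥0∞ :=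
  if x = ⊤ then ⊤ else ENNReal.ofReal x.toReal

/-- Quasi-integrability of an extended-real-valued function: the positive part or the negative
part has finite integral. -/
def QuasiIntegrable {Ω : Type*} [MeasurableSpace Ω] (μ : Measure Ω) (g : Ω → EReal) : Prop :=
  (∫⁻ ω, (g ω).toENNReal' ∂μ) < ⊤ ∨ (∫⁻ ω, (-(g ω)).toENNReal' ∂μ) < ⊤

/-- The integral of an extended-real-valued function, defined as the difference of the
integrals of the positive and negative parts. -/
def eInt {Ω : Type*} [MeasurableSpace Ω] (μ : Measure Ω) (g : Ω → EReal) : EReal :=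
  ((∫⁻ ω, (g ω).toENNReal' ∂μ : ℝ≥0∞) : EReal) - ((∫⁻ ω, (-(g ω)).toENNReal' ∂μ : ℝ≥0∞) : EReal)

/-- `f` is strictly convex at the point `z`. -/
def StrictConvexAt (f : ℝ → EReal) (z : ℝ) : Prop :=
  ∀ x y α : ℝ, x ≠ z → y ≠ z → 0 < α → α < 1 → z = α * x + (1 - α) * y →
    f z < (α : EReal) * f x + ((1 - α : ℝ) : EReal) * f y

/-- The class `𝔽` of proper convex functions `f : ℝ → (-∞, +∞]` with domain contained in
`[0, ∞)`, right-continuous at `0`, with `f 1 = 0` and `1` in the interior of the domain. -/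
structure MemF (f : ℝ → EReal) : Prop where
  ne_bot : ∀ x, f x ≠ ⊥
  convex : ∀ x y α : ℝ, 0 ≤ α → α ≤ 1 →
    f (α * x + (1 - α) * y) ≤ (α : EReal) * f x + ((1 - α : ℝ) : EReal) * f y
  top_of_neg : ∀ x : ℝ, x < 0 → f x = ⊤
  right_continuous_at_zero : Tendsto f (nhdsWithin 0 (Set.Ioi 0)) (nhds (f 0))
  one_eq_zero : f 1 = 0
  one_mem_interior_dom : ∃ ε : ℝ, 0 < ε ∧ ∀ x : ℝ, |x - 1| < ε → f x ≠ ⊤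

/-- The value `f*(0) = lim_{t → ∞} f(t)/t` of the convex conjugate at `0`. -/
def fStarZero (f : ℝ → EReal) : EReal :=
  Filter.limsup (fun t : ℝ => ((t⁻¹ : ℝ) : EReal) * f t) Filter.atTop

/-- The convex conjugate `f*` of `f ∈ 𝔽`: `f*(t) = t f(1/t)` for `t > 0`,
`f*(0) = lim_{t→∞} f(t)/t`, and `f* = ⊤` on negative reals. -/
def fConj (f : ℝ → EReal) : ℝ → EReal := fun t =>
  if 0 < t then ((t : ℝ) : EReal) * f t⁻¹
  else if t = 0 then fStarZero f
  else ⊤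

/-- The ratio `dP/dQ` defined `(P+Q)`-a.e. via densities w.r.t. `λ = P + Q`, with the
conventions `0/0 = ∞/∞ = 0` (which are those of `ℝ≥0∞` division). -/
def rnRatio {Ω : Type*} [MeasurableSpace Ω] (P Q : Measure Ω) : Ω → ℝ≥0∞ :=
  fun ω => P.rnDeriv (P + Q) ω / Q.rnDeriv (P + Q) ω

/-- Extension of `f : ℝ → EReal` to `[0, ∞]`, with value `⊤` at `∞`. -/
def extF (f : ℝ → EReal) : ℝ≥0∞ → EReal :=
  fun x => if x = ⊤ then ⊤ else f x.toReal

/-- The `f`-divergence `D_f(P‖Q) = ∫ f(dP/dQ) dQ + f*(0) P(dP/dQ = ∞)`.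
Note that `Q(dP/dQ = ∞) = 0`, and that in `EReal` one has `f*(0) · 0 = 0`, which encodes the
convention that the second term vanishes when `P(dP/dQ = ∞) = 0`. -/
def fDiv {Ω : Type*} [MeasurableSpace Ω] (f : ℝ → EReal) (P Q : Measure Ω) : EReal :=
  eInt Q (fun ω => extF f (rnRatio P Q ω)) +
    fStarZero f * ((P {ω | rnRatio P Q ω = ⊤} : ℝ≥0∞) : EReal)

/-- The Csiszár index `S_f(X,Y) = D_f(P_X ⊗ P_Y ‖ P_{(X,Y)})`. -/
def csiszarIndex {Ω α β : Type*} [MeasurableSpace Ω] [MeasurableSpace α] [MeasurableSpace β]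
    (f : ℝ → EReal) (μ : Measure Ω) (X : Ω → α) (Y : Ω → β) : EReal :=
  fDiv f ((μ.map X).prod (μ.map Y)) (μ.map (fun ω => (X ω, Y ω)))

theorem EReal.toENNReal'_mono {x y : EReal} (h : x ≤ y) : x.toENNReal' ≤ y.toENNReal' := by
  unfold EReal.toENNReal'
  by_cases hy : y = ⊤
  · simp [hy]
  have hx : x ≠ ⊤ := fun hx => hy (top_le_iff.1 (hx ▸ h))
  rw [if_neg hx, if_neg hy]
  by_cases hb : x = ⊥
  · simp [hb]
  exact ENNReal.ofReal_le_ofReal (EReal.toReal_le_toReal h hb hy)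

theorem EReal.toENNReal'_coe (x : ℝ) : (x : EReal).toENNReal' = ENNReal.ofReal x := by
  simp [EReal.toENNReal']

theorem eInt_mono {Ω : Type*} [MeasurableSpace Ω] {μ : Measure Ω} {g h : Ω → EReal}
    (hgh : ∀ᵐ ω ∂μ, g ω ≤ h ω) : eInt μ g ≤ eInt μ h := by
  refine EReal.sub_le_sub ?_ ?_
  · exact EReal.coe_ennreal_le_coe_ennreal_iff.2
      (lintegral_mono_ae (hgh.mono fun ω hω => EReal.toENNReal'_mono hω))
  · exact EReal.coe_ennreal_le_coe_ennreal_iff.2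
      (lintegral_mono_ae (hgh.mono fun ω hω => EReal.toENNReal'_mono (EReal.neg_le_neg_iff.2 hω)))

theorem eInt_congr {Ω : Type*} [MeasurableSpace Ω] {μ : Measure Ω} {g h : Ω → EReal}
    (hgh : ∀ᵐ ω ∂μ, g ω = h ω) : eInt μ g = eInt μ h :=
  le_antisymm (eInt_mono (hgh.mono fun _ hω => hω.le)) (eInt_mono (hgh.mono fun _ hω => hω.ge))

theorem eInt_coe {Ω : Type*} [MeasurableSpace Ω] {μ : Measure Ω} {φ : Ω → ℝ}
    (hφ : Integrable φ μ) : eInt μ (fun ω => (φ ω : EReal)) = ((∫ ω, φ ω ∂μ : ℝ) : EReal) := by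
  unfold eInt
  simp_rw [← EReal.coe_neg, EReal.toENNReal'_coe]
  rw [integral_eq_lintegral_pos_part_sub_lintegral_neg_part hφ, EReal.coe_sub,
    EReal.coe_ennreal_toReal, EReal.coe_ennreal_toReal]
  · exact hφ.neg.lintegral_lt_top.ne
  · exact hφ.lintegral_lt_top.ne

theorem eInt_const {Ω : Type*} [MeasurableSpace Ω] {μ : Measure Ω} [IsProbabilityMeasure μ]
    {x : EReal} (hx : x ≠ ⊥) : eInt μ (fun _ => x) = x := by
  induction x with
  | bot => exact absurd rfl hx
  | coe x => simpa using eInt_coe (integrable_const (μ := μ) x)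
  | top => simp [eInt, EReal.toENNReal']

theorem measurable_rnRatio {Ω : Type*} [MeasurableSpace Ω] (P Q : Measure Ω) :
    Measurable (rnRatio P Q) :=
  (Measure.measurable_rnDeriv _ _).div (Measure.measurable_rnDeriv _ _)

/-- The Lebesgue decomposition of `P` with respect to `Q` in terms of `rnRatio P Q`. -/
theorem restrict_add_withDensity_rnRatio {Ω : Type*} [MeasurableSpace Ω] (P Q : Measure Ω)
    [IsProbabilityMeasure P] [IsProbabilityMeasure Q] :
    P = P.restrict {ω | Q.rnDeriv (P + Q) ω = 0} + Q.withDensity (rnRatio P Q) := by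
  have hP : P ≪ P + Q := (Measure.le_add_right le_rfl).absolutelyContinuous
  have hQ : Q ≪ P + Q := (Measure.le_add_left le_rfl).absolutelyContinuous
  have hm : MeasurableSet {ω | Q.rnDeriv (P + Q) ω = 0} :=
    Measure.measurable_rnDeriv _ _ (measurableSet_singleton 0)
  have h : Q.withDensity (rnRatio P Q) = P.restrict {ω | Q.rnDeriv (P + Q) ω = 0}ᶜ := by
    have hQ' : Q.withDensity (rnRatio P Q) =
        ((P + Q).withDensity (Q.rnDeriv (P + Q))).withDensity (rnRatio P Q) := by
      rw [Measure.withDensity_rnDeriv_eq Q (P + Q) hQ]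
    have hP' : P.restrict {ω | Q.rnDeriv (P + Q) ω = 0}ᶜ =
        ((P + Q).withDensity (P.rnDeriv (P + Q))).restrict {ω | Q.rnDeriv (P + Q) ω = 0}ᶜ := by
      rw [Measure.withDensity_rnDeriv_eq P (P + Q) hP]
    rw [hQ', hP']
    rw [← withDensity_mul _ (Measure.measurable_rnDeriv _ _) (measurable_rnRatio P Q),
      restrict_withDensity hm.compl, ← withDensity_indicator hm.compl]
    refine withDensity_congr_ae ?_
    filter_upwards [Measure.rnDeriv_lt_top Q (P + Q)] with ω hω
    by_cases h0 : Q.rnDeriv (P + Q) ω = 0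
    · simp [h0]
    · simp [h0, rnRatio, ENNReal.mul_div_cancel h0 hω.ne]
  rw [h, Measure.restrict_add_restrict_compl hm]

theorem rnRatio_ae_eq_rnDeriv {Ω : Type*} [MeasurableSpace Ω] (P Q : Measure Ω)
    [IsProbabilityMeasure P] [IsProbabilityMeasure Q] :
    rnRatio P Q =ᵐ[Q] P.rnDeriv Q := by
  refine Measure.eq_rnDeriv (measurable_rnRatio P Q) ?_ (restrict_add_withDensity_rnRatio P Q)
  have hQ : Q ≪ P + Q := (Measure.le_add_left le_rfl).absolutelyContinuous
  have hm : MeasurableSet {ω | Q.rnDeriv (P + Q) ω = 0} :=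
    Measure.measurable_rnDeriv _ _ (measurableSet_singleton 0)
  refine ⟨{ω | Q.rnDeriv (P + Q) ω = 0}ᶜ, hm.compl, ?_, ?_⟩
  · simp [Measure.restrict_apply hm.compl]
  · rw [compl_compl]
    have := Measure.rnDeriv_pos hQ
    exact measure_eq_zero_iff_ae_notMem.2 (this.mono fun ω hω h => hω.ne' h)

theorem lintegral_rnRatio_add {Ω : Type*} [MeasurableSpace Ω] (P Q : Measure Ω)
    [IsProbabilityMeasure P] [IsProbabilityMeasure Q] :
    ∫⁻ ω, rnRatio P Q ω ∂Q + P {ω | rnRatio P Q ω = ⊤} = 1 := by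
  have hP : P ≪ P + Q := (Measure.le_add_right le_rfl).absolutelyContinuous
  have h : P {ω | rnRatio P Q ω = ⊤} = P {ω | Q.rnDeriv (P + Q) ω = 0} := by
    refine measure_congr ?_
    filter_upwards [Measure.rnDeriv_pos hP, hP (Measure.rnDeriv_lt_top P (P + Q))] with ω h0 h1
    refine propext ?_
    change rnRatio P Q ω = ⊤ ↔ Q.rnDeriv (P + Q) ω = 0
    simp [rnRatio, ENNReal.div_eq_top, h0.ne', h1.ne]
  have h1 := congrArg (fun μ : Measure Ω => μ univ) (restrict_add_withDensity_rnRatio P Q)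
  simp only [measure_univ, Measure.add_apply, Measure.restrict_apply MeasurableSet.univ,
    univ_inter, withDensity_apply _ MeasurableSet.univ, Measure.restrict_univ] at h1
  rw [h, add_comm]
  exact h1.symm

namespace MemF

variable {f : ℝ → EReal}

theorem coe_toReal (hf : MemF f) (hfin : ∀ t : ℝ, 0 < t → f t ≠ ⊤) {t : ℝ} (ht : 0 < t) :
    ((f t).toReal : EReal) = f t :=
  EReal.coe_toReal (hfin t ht) (hf.ne_bot t)

theorem convexOn_toReal (hf : MemF f) (hfin : ∀ t : ℝ, 0 < t → f t ≠ ⊤) :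
    ConvexOn ℝ (Ioi 0) (fun t => (f t).toReal) := by
  refine ⟨convex_Ioi 0, fun x hx y hy a b ha hb hab => ?_⟩
  have h := hf.convex x y a ha (by linarith)
  have hpos : 0 < a * x + (1 - a) * y := by
    have := convex_Ioi (0 : ℝ) hx hy ha hb hab
    obtain rfl : b = 1 - a := by linarith
    exact this
  rw [← hf.coe_toReal hfin hpos, ← hf.coe_toReal hfin hx, ← hf.coe_toReal hfin hy] at h
  obtain rfl : b = 1 - a := by linarith
  simpa using (by exact_mod_cast h :
    (f (a * x + (1 - a) * y)).toReal ≤ a * (f x).toReal + (1 - a) * (f y).toReal)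

/-- A subgradient of `f` at `1` gives an affine minorant on `[0, ∞)`; its slope bounds `f*(0)`. -/
theorem exists_affine_minorant (hf : MemF f) (hfin : ∀ t : ℝ, 0 < t → f t ≠ ⊤) :
    ∃ c : ℝ, (∀ t : ℝ, 0 ≤ t → ((c * (t - 1) : ℝ) : EReal) ≤ f t) ∧ (c : EReal) ≤ fStarZero f := by
  have hc := hf.convexOn_toReal hfin
  have h1 : (f 1).toReal = 0 := by simp [hf.one_eq_zero]
  have hint : (1 : ℝ) ∈ interior (Ioi (0 : ℝ)) := by simp
  obtain ⟨c, hc'⟩ : ∃ c : ℝ, ∀ t : ℝ, 0 < t → c * (t - 1) ≤ (f t).toReal := by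
    refine ⟨derivWithin (fun t => (f t).toReal) (Ioi 1) 1, fun t ht => ?_⟩
    rcases lt_trichotomy t 1 with h | rfl | h
    · have h2 := (hc.slope_le_leftDeriv_of_mem_interior ht hint h).trans
        (hc.leftDeriv_le_rightDeriv_of_mem_interior hint)
      rw [slope_def_field, h1, div_le_iff₀ (by linarith)] at h2
      linarith
    · simp [h1]
    · have h2 := hc.rightDeriv_le_slope_of_mem_interior hint ht h
      rw [slope_def_field, h1, le_div_iff₀ (by linarith)] at h2
      linarith
  have hlow : ∀ t : ℝ, 0 < t → ((c * (t - 1) : ℝ) : EReal) ≤ f t := fun t ht => by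
    rw [← hf.coe_toReal hfin ht]; exact_mod_cast hc' t ht
  refine ⟨c, fun t ht => ?_, ?_⟩
  · rcases ht.eq_or_lt with rfl | ht
    · have hcont : Tendsto (fun t : ℝ => ((c * (t - 1) : ℝ) : EReal)) (𝓝[>] 0)
          (𝓝 ((c * (0 - 1) : ℝ) : EReal)) :=
        ((continuous_coe_real_ereal.comp (by fun_prop : Continuous fun t : ℝ => c * (t - 1))).tendsto
          0).mono_left nhdsWithin_le_nhds
      exact le_of_tendsto_of_tendsto hcont hf.right_continuous_at_zero
        (eventually_nhdsWithin_of_forall hlow)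
    · exact hlow t ht
  · have hlim : Tendsto (fun t : ℝ => ((c * (1 - t⁻¹) : ℝ) : EReal)) atTop (𝓝 (c : EReal)) := by
      have : Tendsto (fun t : ℝ => c * (1 - t⁻¹)) atTop (𝓝 (c * (1 - 0))) :=
        (tendsto_const_nhds.sub tendsto_inv_atTop_zero).const_mul c
      simp only [sub_zero, mul_one] at this
      exact (continuous_coe_real_ereal.tendsto c).comp this
    rw [← hlim.limsup_eq]
    refine limsup_le_limsup ?_
    filter_upwards [eventually_gt_atTop 0] with t ht
    rw [← hf.coe_toReal hfin ht]
    have : c * (1 - t⁻¹) ≤ t⁻¹ * (f t).toReal := by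
      rw [← div_eq_inv_mul, le_div_iff₀ ht]
      have := hc' t ht
      field_simp
      linarith
    exact_mod_cast this

theorem fStarZero_ne_bot (hf : MemF f) (hfin : ∀ t : ℝ, 0 < t → f t ≠ ⊤) : fStarZero f ≠ ⊥ := by
  obtain ⟨c, -, h⟩ := hf.exists_affine_minorant hfin
  exact ne_bot_of_le_ne_bot (EReal.coe_ne_bot c) h

theorem le_affine (hf : MemF f) (hfin : ∀ t : ℝ, 0 < t → f t ≠ ⊤) {a b : ℝ}
    (ha : f 0 = a) (hb : fStarZero f = b) {t : ℝ} (ht : 0 ≤ t) :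
    f t ≤ ((a + t * b : ℝ) : EReal) := by
  rcases ht.eq_or_lt with rfl | ht
  · simp [ha]
  rw [← hf.coe_toReal hfin ht]
  norm_cast
  refine le_of_forall_pos_le_add fun ε hε => ?_
  have hev : ∀ᶠ s : ℝ in atTop, ((s⁻¹ : ℝ) : EReal) * f s < ((b + ε / t : ℝ) : EReal) := by
    refine eventually_lt_of_limsup_lt ?_
    change fStarZero f < _
    rw [hb]
    exact_mod_cast lt_add_of_pos_right b (div_pos hε ht)
  have hlim : Tendsto (fun s : ℝ => (1 - t * s⁻¹) * a + t * (b + ε / t)) atTop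
      (𝓝 ((1 - t * 0) * a + t * (b + ε / t))) :=
    ((tendsto_const_nhds.sub (tendsto_inv_atTop_zero.const_mul t)).mul_const a).add_const _
  have hle : (f t).toReal ≤ (1 - t * 0) * a + t * (b + ε / t) := by
    refine ge_of_tendsto hlim ?_
    filter_upwards [hev, eventually_gt_atTop t] with s hs hts
    have hs0 : 0 < s := ht.trans hts
    have h := hf.convex s 0 (t * s⁻¹) (by positivity)
      (by rw [← div_eq_mul_inv]; exact (div_le_one hs0).2 hts.le)
    rw [show t * s⁻¹ * s + (1 - t * s⁻¹) * 0 = t by field_simp; ring, ha,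
      ← hf.coe_toReal hfin hs0, ← hf.coe_toReal hfin ht] at h
    rw [← hf.coe_toReal hfin hs0] at hs
    have h' : (f t).toReal ≤ t * s⁻¹ * (f s).toReal + (1 - t * s⁻¹) * a := by exact_mod_cast h
    have hs' : s⁻¹ * (f s).toReal < b + ε / t := by exact_mod_cast hs
    nlinarith
  have : t * (ε / t) = ε := by field_simp
  linarith

theorem exists_lt_of_lt_add (hf : MemF f) (hfin : ∀ t : ℝ, 0 < t → f t ≠ ⊤) {d : ℝ}
    (hd : (d : EReal) < f 0 + fStarZero f) :
    ∃ t : ℝ, 1 ≤ t ∧ d < (1 + t)⁻¹ * (f t).toReal + t * (1 + t)⁻¹ * (f t⁻¹).toReal := by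
  obtain ⟨a, ha, b, hb, hab⟩ : ∃ a < f 0, ∃ b < fStarZero f, (d : EReal) < a + b := by
    by_contra! h
    exact hd.not_ge (EReal.add_le_of_forall_lt h)
  induction a with
  | top => exact absurd ha not_top_lt
  | bot => simp at hab
  | coe a =>
  induction b with
  | top => exact absurd hb not_top_lt
  | bot => simp at hab
  | coe b =>
  have hab' : d < a + b := by exact_mod_cast hab
  have hfreq := frequently_lt_of_lt_limsup (by isBoundedDefault) hb
  have h0 : ∀ᶠ t : ℝ in atTop, (a : EReal) < f t⁻¹ :=
    tendsto_inv_atTop_nhdsGT_zero.eventually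
      (hf.right_continuous_at_zero.eventually (lt_mem_nhds ha))
  have hlim : Tendsto (fun t : ℝ => (1 - (1 + t)⁻¹) * (a + b)) atTop (𝓝 ((1 - 0) * (a + b))) :=
    (tendsto_const_nhds.sub (tendsto_inv_atTop_zero.comp
      (tendsto_atTop_add_const_left _ 1 tendsto_id))).mul_const _
  have h1 : ∀ᶠ t : ℝ in atTop, d < (1 - (1 + t)⁻¹) * (a + b) :=
    hlim.eventually (lt_mem_nhds (by linarith))
  obtain ⟨t, hbt, hat, hdt, ht⟩ :=
    (hfreq.and_eventually (h0.and (h1.and (eventually_ge_atTop 1)))).exists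
  refine ⟨t, ht, hdt.trans_le ?_⟩
  have ht0 : 0 < t := by linarith
  rw [← hf.coe_toReal hfin ht0] at hbt
  rw [← hf.coe_toReal hfin (inv_pos.2 ht0)] at hat
  have hat' : a < (f t⁻¹).toReal := by exact_mod_cast hat
  have hbt' : b < t⁻¹ * (f t).toReal := by exact_mod_cast hbt
  have e : 1 - (1 + t)⁻¹ = t * (1 + t)⁻¹ := by field_simp; ring
  have e2 : (1 + t)⁻¹ * (f t).toReal = t * (1 + t)⁻¹ * (t⁻¹ * (f t).toReal) := by field_simp
  rw [e, e2, ← mul_add]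
  exact mul_le_mul_of_nonneg_left (by linarith) (by positivity)

theorem continuousOn_twoPoint (hf : MemF f) (hfin : ∀ t : ℝ, 0 < t → f t ≠ ⊤) :
    ContinuousOn (fun t : ℝ => (1 + t)⁻¹ * (f t).toReal + t * (1 + t)⁻¹ * (f t⁻¹).toReal)
      (Ioi 0) := by
  have hc := (hf.convexOn_toReal hfin).continuousOn isOpen_Ioi
  have hinv : ContinuousOn (fun t : ℝ => t⁻¹) (Ioi 0) :=
    continuousOn_inv₀.mono fun t ht => ne_of_gt ht
  have h1 : ContinuousOn (fun t : ℝ => (1 + t)⁻¹) (Ioi 0) :=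
    ContinuousOn.inv₀ (by fun_prop) fun t (ht : 0 < t) => by positivity
  exact (h1.mul hc).add ((continuousOn_id.mul h1).mul
    (hc.comp hinv fun t (ht : 0 < t) => inv_pos.2 ht))

section fDiv

variable {Ω : Type*} [MeasurableSpace Ω]

theorem fDiv_mem_Icc (hf : MemF f) (hfin : ∀ t : ℝ, 0 < t → f t ≠ ⊤) (P Q : Measure Ω)
    [IsProbabilityMeasure P] [IsProbabilityMeasure Q] :
    fDiv f P Q ∈ Icc 0 (f 0 + fStarZero f) := by
  have hsum := lintegral_rnRatio_add P Q
  have hr : ∫⁻ ω, rnRatio P Q ω ∂Q ≠ ⊤ := by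
    intro h; simp [h] at hsum
  have hm : P {ω | rnRatio P Q ω = ⊤} ≠ ⊤ := measure_ne_top _ _
  have htop : ∀ᵐ ω ∂Q, rnRatio P Q ω < ⊤ := ae_lt_top (measurable_rnRatio P Q) hr
  have hint : Integrable (fun ω => (rnRatio P Q ω).toReal) Q :=
    integrable_toReal_of_lintegral_ne_top (measurable_rnRatio P Q).aemeasurable hr
  set m := (P {ω | rnRatio P Q ω = ⊤}).toReal with hmdef
  have hcoe : ((P {ω | rnRatio P Q ω = ⊤} : ℝ≥0∞) : EReal) = (m : EReal) :=
    (EReal.coe_ennreal_toReal hm).symm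
  have hm0 : 0 ≤ m := ENNReal.toReal_nonneg
  have hI : ∫ ω, (rnRatio P Q ω).toReal ∂Q = 1 - m := by
    rw [integral_toReal (measurable_rnRatio P Q).aemeasurable htop]
    have := congrArg ENNReal.toReal hsum
    rw [ENNReal.toReal_add hr hm] at this
    simp only [ENNReal.toReal_one] at this
    linarith
  unfold fDiv
  rw [hcoe]
  constructor
  · obtain ⟨c, hc, hcs⟩ := hf.exists_affine_minorant hfin
    have h1 : ((-(c * m) : ℝ) : EReal) ≤ eInt Q (fun ω => extF f (rnRatio P Q ω)) := by
      have hi : Integrable (fun ω => c * ((rnRatio P Q ω).toReal - 1)) Q :=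
        (hint.sub (integrable_const 1)).const_mul c
      have he : ∫ ω, c * ((rnRatio P Q ω).toReal - 1) ∂Q = -(c * m) := by
        rw [integral_const_mul, integral_sub hint (integrable_const 1), hI]
        simp
      rw [← he, ← eInt_coe hi]
      refine eInt_mono (htop.mono fun ω hω => ?_)
      simp only [extF, hω.ne, if_false]
      exact hc _ ENNReal.toReal_nonneg
    have h2 : ((c * m : ℝ) : EReal) ≤ fStarZero f * (m : EReal) := by
      rw [EReal.coe_mul]
      exact mul_le_mul_of_nonneg_right hcs (by exact_mod_cast hm0)
    calc (0 : EReal) = ((-(c * m) : ℝ) : EReal) + ((c * m : ℝ) : EReal) := by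
          rw [← EReal.coe_add]; simp
      _ ≤ _ := add_le_add h1 h2
  · have hf0 := hf.ne_bot 0
    have hfs := hf.fStarZero_ne_bot hfin
    by_cases h0 : f 0 = ⊤
    · rw [h0, EReal.top_add_of_ne_bot hfs]; exact le_top
    by_cases hs : fStarZero f = ⊤
    · rw [hs, EReal.add_top_of_ne_bot hf0]; exact le_top
    obtain ⟨a, ha⟩ : ∃ a : ℝ, f 0 = a := ⟨_, (EReal.coe_toReal h0 hf0).symm⟩
    obtain ⟨b, hb⟩ : ∃ b : ℝ, fStarZero f = b := ⟨_, (EReal.coe_toReal hs hfs).symm⟩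
    have h1 : eInt Q (fun ω => extF f (rnRatio P Q ω)) ≤ ((a + (1 - m) * b : ℝ) : EReal) := by
      have hi : Integrable (fun ω => a + (rnRatio P Q ω).toReal * b) Q :=
        (integrable_const a).add (hint.mul_const b)
      have he : ∫ ω, (a + (rnRatio P Q ω).toReal * b) ∂Q = a + (1 - m) * b := by
        rw [integral_add (integrable_const a) (hint.mul_const b), integral_mul_const, hI]
        simp
      rw [← he, ← eInt_coe hi]
      refine eInt_mono (htop.mono fun ω hω => ?_)
      simp only [extF, hω.ne, if_false]
      exact hf.le_affine hfin ha hb ENNReal.toReal_nonneg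
    calc _ ≤ ((a + (1 - m) * b : ℝ) : EReal) + fStarZero f * (m : EReal) := add_le_add_left h1 _
      _ = f 0 + fStarZero f := by
        rw [ha, hb]
        norm_cast
        ring

theorem fDiv_of_mutuallySingular (hf : MemF f) (P Q : Measure Ω) [IsProbabilityMeasure P]
    [IsProbabilityMeasure Q] (h : P ⟂ₘ Q) : fDiv f P Q = f 0 + fStarZero f := by
  have h0 : rnRatio P Q =ᵐ[Q] 0 := (rnRatio_ae_eq_rnDeriv P Q).trans h.rnDeriv_ae_eq_zero
  have hsum := lintegral_rnRatio_add P Q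
  rw [lintegral_congr_ae h0] at hsum
  simp only [Pi.zero_apply, lintegral_zero, zero_add] at hsum
  have he : eInt Q (fun ω => extF f (rnRatio P Q ω)) = f 0 := by
    rw [← eInt_const (μ := Q) (hf.ne_bot 0)]
    exact eInt_congr (h0.mono fun ω hω => by simp [hω, extF])
  rw [fDiv, hsum, he]
  simp

open scoped Classical in
theorem exists_fDiv_eq_twoPoint (hf : MemF f) (hfin : ∀ t : ℝ, 0 < t → f t ≠ ⊤) {A : Set Ω}
    (hA : MeasurableSet A) {x y : Ω} (hx : x ∈ A) (hy : y ∉ A) {t : ℝ} (ht : 0 < t) :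
    ∃ P Q : Measure Ω, IsProbabilityMeasure P ∧ IsProbabilityMeasure Q ∧
      fDiv f P Q =
        (((1 + t)⁻¹ * (f t).toReal + t * (1 + t)⁻¹ * (f t⁻¹).toReal : ℝ) : EReal) := by
  set Q : Measure Ω := ENNReal.ofReal (1 + t)⁻¹ • Measure.dirac x +
    ENNReal.ofReal (t * (1 + t)⁻¹) • Measure.dirac y with hQdef
  have hsum1 : (1 + t)⁻¹ + t * (1 + t)⁻¹ = 1 := by field_simp
  have hQ : IsProbabilityMeasure Q := ⟨by
    simp only [hQdef, Measure.add_apply, Measure.smul_apply, measure_univ, smul_eq_mul, mul_one]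
    rw [← ENNReal.ofReal_add (by positivity) (by positivity), hsum1, ENNReal.ofReal_one]⟩
  set u : Ω → ℝ≥0∞ := A.piecewise (fun _ => ENNReal.ofReal t) (fun _ => ENNReal.ofReal t⁻¹) with hu
  have hum : Measurable u := Measurable.piecewise hA measurable_const measurable_const
  have hux : u x = ENNReal.ofReal t := by simp [hu, hx]
  have huy : u y = ENNReal.ofReal t⁻¹ := by simp [hu, hy]
  have hint : ∫⁻ ω, u ω ∂Q = 1 := by
    rw [hQdef, lintegral_add_measure, lintegral_smul_measure, lintegral_smul_measure,
      lintegral_dirac' _ hum, lintegral_dirac' _ hum, hux, huy, smul_eq_mul, smul_eq_mul,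
      ← ENNReal.ofReal_mul (by positivity), ← ENNReal.ofReal_mul (by positivity),
      ← ENNReal.ofReal_add (by positivity) (by positivity)]
    rw [show (1 + t)⁻¹ * t + t * (1 + t)⁻¹ * t⁻¹ = 1 by field_simp; ring, ENNReal.ofReal_one]
  have hP : IsProbabilityMeasure (Q.withDensity u) := ⟨by
    rw [withDensity_apply _ MeasurableSet.univ, Measure.restrict_univ, hint]⟩
  refine ⟨Q.withDensity u, Q, hP, hQ, ?_⟩
  have hr : rnRatio (Q.withDensity u) Q =ᵐ[Q] u :=
    (rnRatio_ae_eq_rnDeriv _ _).trans (Measure.rnDeriv_withDensity Q hum)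
  have hsum := lintegral_rnRatio_add (Q.withDensity u) Q
  rw [lintegral_congr_ae hr, hint] at hsum
  have hzero : Q.withDensity u {ω | rnRatio (Q.withDensity u) Q ω = ⊤} = 0 :=
    (ENNReal.add_right_inj ENNReal.one_ne_top).1 (hsum.trans (add_zero 1).symm)
  set φ : Ω → ℝ := A.piecewise (fun _ => (f t).toReal) (fun _ => (f t⁻¹).toReal) with hφ
  have hφm : StronglyMeasurable φ :=
    (Measurable.piecewise hA measurable_const measurable_const).stronglyMeasurable
  have hix : Integrable φ (ENNReal.ofReal (1 + t)⁻¹ • Measure.dirac x) :=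
    (integrable_dirac' hφm (by simp)).smul_measure ENNReal.ofReal_ne_top
  have hiy : Integrable φ (ENNReal.ofReal (t * (1 + t)⁻¹) • Measure.dirac y) :=
    (integrable_dirac' hφm (by simp)).smul_measure ENNReal.ofReal_ne_top
  have he : eInt Q (fun ω => extF f (rnRatio (Q.withDensity u) Q ω)) =
      ((∫ ω, φ ω ∂Q : ℝ) : EReal) := by
    rw [← eInt_coe (hix.add_measure hiy)]
    refine eInt_congr (hr.mono fun ω hω => ?_)
    rw [hω]
    by_cases h : ω ∈ A
    · simp [hu, hφ, h, extF, ht.le, hf.coe_toReal hfin ht]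
    · simp [hu, hφ, h, extF, ht.le, hf.coe_toReal hfin (inv_pos.2 ht)]
  rw [fDiv, hzero, he, hQdef, integral_add_measure hix hiy, integral_smul_measure,
    integral_smul_measure, integral_dirac' _ _ hφm, integral_dirac' _ _ hφm,
    ENNReal.toReal_ofReal (by positivity), ENNReal.toReal_ofReal (by positivity)]
  simp [hφ, hx, hy]

end fDiv

end MemF

/-- **Range of the `f`-divergence.** On a measurable space with a non-trivial σ-field, if
`f ∈ 𝔽` is finite on `(0, ∞)`, then the set of values of `D_f(P‖Q)` over all pairs of
probability measures is exactly the interval `[0, f(0) + f*(0)]`. -/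
theorem fDiv_range
    {Ω : Type*} [MeasurableSpace Ω]
    (hΩ : ∃ A : Set Ω, MeasurableSet A ∧ A.Nonempty ∧ A ≠ Set.univ)
    (f : ℝ → EReal) (hf : MemF f) (hfin : ∀ t : ℝ, 0 < t → f t ≠ ⊤) :
    {d : EReal | ∃ P Q : Measure Ω,
        IsProbabilityMeasure P ∧ IsProbabilityMeasure Q ∧ fDiv f P Q = d} =
      Set.Icc 0 (f 0 + fStarZero f) := by
  obtain ⟨A, hA, ⟨x, hx⟩, hA'⟩ := hΩ
  obtain ⟨y, hy⟩ := (ne_univ_iff_exists_notMem A).1 hA'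
  ext d
  constructor
  · rintro ⟨P, Q, hP, hQ, rfl⟩
    exact hf.fDiv_mem_Icc hfin P Q
  rintro ⟨hd0, hd⟩
  rcases hd.eq_or_lt with rfl | hd
  · refine ⟨Measure.dirac x, Measure.dirac y, inferInstance, inferInstance,
      hf.fDiv_of_mutuallySingular _ _ ⟨Aᶜ, hA.compl, ?_, ?_⟩⟩
    · simp [Measure.dirac_apply' _ hA.compl, hx]
    · simp [Measure.dirac_apply' _ hA, hy]
  lift d to ℝ using ⟨hd.ne_top, ne_bot_of_le_ne_bot EReal.zero_ne_bot hd0⟩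
  obtain ⟨t, ht, hdt⟩ := hf.exists_lt_of_lt_add hfin hd
  have hd0' : 0 ≤ d := by exact_mod_cast hd0
  obtain ⟨s, hs, hsd⟩ := intermediate_value_Icc ht
    ((hf.continuousOn_twoPoint hfin).mono fun s hs => zero_lt_one.trans_le hs.1)
    ⟨by simpa [hf.one_eq_zero] using hd0', hdt.le⟩
  obtain ⟨P, Q, hP, hQ, h⟩ :=
    hf.exists_fDiv_eq_twoPoint hfin hA hx hy (zero_lt_one.trans_le hs.1)
  exact ⟨P, Q, hP, hQ, h.trans (congrArg _ hsd)⟩
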